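/- arXiv:2310.00850 — 4 statements merged into one kernel-verified Lean document; each statement's English description precedes it below -/
import Mathlib

section
/- Let X be a set and let S be a vector space of real-valued functions on X of finite dimension m > 0 which is closed under the pointwise absolute-value operation ψ ↦ |ψ| and under some m-argument operation Π sending any ψ₁, …, ψₘ ∈ S to a function Π(ψ₁,…,ψₘ) ∈ S that is nonnegative everywhere and vanishes at a point x ∈ X if and only if the product ψ₁(x)⋯ψₘ(x) vanishes. Then for any two functions φ, ψ ∈ S, the ratio φ(x)/ψ(x) attains at most m distinct values as x ranges over the set {x ∈ X : ψ(x) ≠ 0}. -/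
/-- Let `S` be a vector space of real-valued functions on a set `X`, of finite
dimension `m > 0`, closed under the pointwise absolute value and under some
`m`-argument operation `Π` producing nonnegative functions in `S` having exactly
the same zeros as the corresponding pointwise products.  Then for any `φ, ψ ∈ S`
the ratio `φ x / ψ x` attains at most `m` distinct values as `x` ranges over
`{x | ψ x ≠ 0}`. -/
theorem stmt_1 {X : Type*} (S : Submodule ℝ (X → ℝ)) (m : ℕ) (hm : 0 < m)
    (hdim : Module.finrank ℝ S = m)
    (habs : ∀ ψ ∈ S, (fun x => |ψ x|) ∈ S)
    (Pi : (Fin m → (X → ℝ)) → (X → ℝ))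
    (hPiMem : ∀ ψ : Fin m → (X → ℝ), (∀ i, ψ i ∈ S) → Pi ψ ∈ S)
    (hPiNonneg : ∀ ψ : Fin m → (X → ℝ), (∀ i, ψ i ∈ S) → ∀ x, 0 ≤ Pi ψ x)
    (hPiZeros : ∀ ψ : Fin m → (X → ℝ), (∀ i, ψ i ∈ S) →
      ∀ x, Pi ψ x = 0 ↔ (∏ i, ψ i x) = 0)
    (φ ψ : X → ℝ) (hφ : φ ∈ S) (hψ : ψ ∈ S) :
    ∃ T : Finset ℝ, T.card ≤ m ∧ ∀ x : X, ψ x ≠ 0 → φ x / ψ x ∈ T := by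
  classical
  set R : Set ℝ := {r | ∃ x, ψ x ≠ 0 ∧ φ x / ψ x = r} with hR
  by_cases hle : R.encard ≤ m
  · have hfin : R.Finite := Set.finite_of_encard_le_coe hle
    refine ⟨hfin.toFinset, ?_, ?_⟩
    · rw [hfin.encard_eq_coe_toFinset_card] at hle
      exact_mod_cast hle
    · intro x hx
      rw [Set.Finite.mem_toFinset]
      exact ⟨x, hx, rfl⟩
  exfalso
  have hge : ((m + 1 : ℕ) : ℕ∞) ≤ R.encard := by
    push_cast
    exact Order.add_one_le_of_lt (not_le.mp hle)
  obtain ⟨t, htR, ht⟩ := Set.exists_subset_encard_eq hge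
  have htf : t.Finite := Set.finite_of_encard_eq_coe ht
  have hc : htf.toFinset.card = m + 1 := by
    rw [htf.encard_eq_coe_toFinset_card] at ht
    exact_mod_cast ht
  let c : Fin (m + 1) → ℝ := htf.toFinset.orderEmbOfFin hc
  have hcinj : Function.Injective c := (htf.toFinset.orderEmbOfFin hc).injective
  have hcR : ∀ i, c i ∈ R := fun i =>
    htR (htf.mem_toFinset.mp (htf.toFinset.orderEmbOfFin_mem hc i))
  choose p hp hpc using hcR
  let g : Fin (m + 1) → X → ℝ := fun j => ψ (p j) • φ - φ (p j) • ψ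
  have hg : ∀ j, g j ∈ S := fun j => S.sub_mem (S.smul_mem _ hφ) (S.smul_mem _ hψ)
  have hg0 : ∀ j, g j (p j) = 0 := by
    intro j
    simp [g]
    ring
  have hg1 : ∀ i j, i ≠ j → g j (p i) ≠ 0 := by
    intro i j hij h
    apply hij
    apply hcinj
    rw [← hpc i, ← hpc j, div_eq_div_iff (hp i) (hp j)]
    simp [g] at h
    linarith
  have hmem : ∀ i : Fin (m + 1), ∀ k : Fin m, g (i.succAbove k) ∈ S := fun i k => hg _
  let f : Fin (m + 1) → S := fun i =>
    ⟨Pi (fun k => g (i.succAbove k)), hPiMem _ (hmem i)⟩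
  have hf1 : ∀ i, (f i : X → ℝ) (p i) ≠ 0 := by
    intro i h
    have h2 := (hPiZeros _ (hmem i) (p i)).mp h
    obtain ⟨k, -, hk⟩ := Finset.prod_eq_zero_iff.mp h2
    exact hg1 _ _ (Fin.succAbove_ne i k).symm hk
  have hf0 : ∀ i j, j ≠ i → (f i : X → ℝ) (p j) = 0 := by
    intro i j hij
    refine (hPiZeros _ (hmem i) (p j)).mpr ?_
    obtain ⟨k, rfl⟩ := Fin.exists_succAbove_eq hij
    exact Finset.prod_eq_zero (Finset.mem_univ k) (hg0 _)
  have hli : LinearIndependent ℝ f := by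
    rw [Fintype.linearIndependent_iff]
    intro a ha i
    have h := congrArg (fun s : S => (s : X → ℝ) (p i)) ha
    simp only [Submodule.coe_sum, Submodule.coe_smul, Finset.sum_apply, _root_.Pi.smul_apply,
      smul_eq_mul, Submodule.coe_zero, _root_.Pi.zero_apply] at h
    rw [Finset.sum_eq_single i (fun j _ hj => by rw [hf0 j i hj.symm, mul_zero])
      (fun h => absurd (Finset.mem_univ i) h)] at h
    exact (mul_eq_zero.mp h).resolve_right (hf1 i)
  haveI : FiniteDimensional ℝ S := FiniteDimensional.of_finrank_pos (by omega)
  have := hli.fintype_card_le_finrank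
  simp [hdim] at this
end

section
/- Let I ⊆ ℝ be a nonempty open interval and let f : I → ℝ be differentiable and nonconstant. Suppose that for every connected component J of the open set {t ∈ I : f(t) ≠ 0} there exists a constant c_J ≥ 0 such that |f′(t)| = c_J · |f(t)|^{3/2} for all t ∈ J. Then f(t) ≠ 0 for every t ∈ I, and there exist a real number ε ≠ 0 and a real number b ∉ I such that f(t) = ε·(t − b)^{−2} for all t ∈ I. -/
theorem aux_deriv (f : ℝ → ℝ) (a t c : ℝ) (h : HasDerivAt f a t) (h0 : f t ≠ 0)
    (hc : |a| = c * |f t| ^ ((3 : ℝ) / 2)) :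
    ∃ d, HasDerivAt (fun s => (f s ^ 2) ^ (-(1 : ℝ) / 4)) d t ∧ |d| = c / 2 := by
  have hp : 0 < |f t| := abs_pos.mpr h0
  have h1 := (h.pow 2).rpow_const (p := -(1 : ℝ) / 4) (Or.inl (pow_ne_zero 2 h0))
  refine ⟨_, h1, ?_⟩
  have e1 : (f t ^ 2) ^ (-(1 : ℝ) / 4 - 1) = |f t| ^ (-(5 : ℝ) / 2) := by
    rw [← sq_abs, ← Real.rpow_natCast, ← Real.rpow_mul hp.le]
    norm_num
  have e2 : |f t| ^ (-(5 : ℝ) / 2) * |f t| * |f t| ^ ((3 : ℝ) / 2) = 1 := by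
    nth_rewrite 2 [← Real.rpow_one |f t|]
    rw [← Real.rpow_add hp, ← Real.rpow_add hp]
    norm_num
  simp only [Pi.pow_apply]
  rw [e1]
  simp only [abs_mul, hc]
  rw [abs_of_pos (Real.rpow_pos_of_pos hp _)]
  norm_num at e2 ⊢
  rw [show (-5 / 2 : ℝ) = -(5 / 2) by norm_num] at *
  linear_combination (c / 2) * e2

theorem aux_affine (J : Set ℝ) (hJ : IsOpen J) (hJc : IsPreconnected J) (x : ℝ) (hx : x ∈ J)
    (g g' : ℝ → ℝ) (k : ℝ) (hg : ∀ t ∈ J, HasDerivAt g (g' t) t) (hk : ∀ t ∈ J, |g' t| = k) :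
    ∃ m q, ∀ t ∈ J, g t = m * t + q := by
  have hm : ∃ m, ∀ t ∈ J, g' t = m := by
    by_cases h0 : k = 0
    · exact ⟨0, fun t ht => by simpa [h0] using hk t ht⟩
    · rcases hasDerivWithinAt_forall_lt_or_forall_gt_of_forall_ne (m := 0)
        hJc.ordConnected.convex (fun t ht => (hg t ht).hasDerivWithinAt)
        (fun t ht h => h0 (by rw [← hk t ht, h, abs_zero])) with h | h
      · exact ⟨-k, fun t ht => by rw [← hk t ht, abs_of_neg (h t ht)]; ring⟩
      · exact ⟨k, fun t ht => by rw [← hk t ht, abs_of_pos (h t ht)]⟩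
  obtain ⟨m, hm⟩ := hm
  refine ⟨m, g x - m * x, fun t ht => ?_⟩
  have hd : ∀ t ∈ J, HasDerivAt (fun s => g s - m * s) 0 t := fun t ht => by
    have := (hg t ht).sub ((hasDerivAt_id t).const_mul m)
    have h2 : g' t - m * 1 = 0 := by rw [hm t ht]; ring
    rw [h2] at this
    exact this
  have : g t - m * t = g x - m * x := hJ.is_const_of_deriv_eq_zero hJc
    (fun t ht => (hd t ht).differentiableAt.differentiableWithinAt)
    (fun t ht => (hd t ht).deriv) ht hx
  linarith

/-- Let `I ⊆ ℝ` be a nonempty open interval and `f` a differentiable nonconstant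
real-valued function on `I`.  If on every connected component `J` of the open set
`{t ∈ I | f t ≠ 0}` there is a constant `c_J ≥ 0` with `|f'| = c_J ⬝ |f|^{3/2}` on `J`,
then `f` is nowhere zero on `I` and `f(t) = ε (t - b)⁻²` for some `ε ≠ 0` and
some `b ∉ I`. -/
theorem stmt_2 (I : Set ℝ) (hI : IsOpen I) (hIconn : I.OrdConnected)
    (hIne : I.Nonempty)
    (f f' : ℝ → ℝ) (hderiv : ∀ t ∈ I, HasDerivAt f (f' t) t)
    (hnonconst : ∃ s ∈ I, ∃ t ∈ I, f s ≠ f t)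
    (hcomp : ∀ x ∈ I, f x ≠ 0 → ∃ c : ℝ, 0 ≤ c ∧
      ∀ t ∈ connectedComponentIn {s ∈ I | f s ≠ 0} x,
        |f' t| = c * |f t| ^ ((3 : ℝ) / 2)) :
    (∀ t ∈ I, f t ≠ 0) ∧
      ∃ ε : ℝ, ε ≠ 0 ∧ ∃ b : ℝ, b ∉ I ∧ ∀ t ∈ I, f t = ε * ((t - b) ^ 2)⁻¹ := by
  have hcont : ContinuousOn f I := fun t ht => (hderiv t ht).continuousAt.continuousWithinAt
  have hIp : IsPreconnected I := hIconn.isPreconnected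
  obtain ⟨x, hxI, hx0⟩ : ∃ x ∈ I, f x ≠ 0 := by
    obtain ⟨s, hs, t, ht, hst⟩ := hnonconst
    by_cases h : f s = 0
    · exact ⟨t, ht, fun h' => hst (h.trans h'.symm)⟩
    · exact ⟨s, hs, h⟩
  obtain ⟨c, -, hc⟩ := hcomp x hxI hx0
  set S : Set ℝ := {s ∈ I | f s ≠ 0} with hS
  set J := connectedComponentIn S x with hJdef
  have hSo : IsOpen S := hcont.isOpen_inter_preimage hI isOpen_compl_singleton
  have hJo : IsOpen J := hSo.connectedComponentIn
  have hJp : IsPreconnected J := isPreconnected_connectedComponentIn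
  have hxJ : x ∈ J := mem_connectedComponentIn ⟨hxI, hx0⟩
  have hJS : J ⊆ S := connectedComponentIn_subset S x
  have hex : ∀ t, ∃ d, t ∈ J →
      HasDerivAt (fun s => (f s ^ 2) ^ (-(1 : ℝ) / 4)) d t ∧ |d| = c / 2 := fun t => by
    by_cases ht : t ∈ J
    · obtain ⟨d, hd⟩ := aux_deriv f (f' t) t c (hderiv t (hJS ht).1) (hJS ht).2 (hc t ht)
      exact ⟨d, fun _ => hd⟩
    · exact ⟨0, fun h => absurd h ht⟩
  choose g' hg' using hex
  obtain ⟨m, q, hmq⟩ := aux_affine J hJo hJp x hxJ _ g' (c / 2)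
    (fun t ht => (hg' t ht).1) (fun t ht => (hg' t ht).2)
  have key : ∀ t ∈ J, |f t| * (m * t + q) ^ 2 = 1 := fun t ht => by
    have hp : 0 < |f t| := abs_pos.mpr (hJS ht).2
    rw [← hmq t ht, ← sq_abs (f t), ← Real.rpow_natCast |f t|, ← Real.rpow_mul hp.le,
      ← Real.rpow_natCast, ← Real.rpow_mul hp.le]
    nth_rewrite 1 [← Real.rpow_one |f t|]
    rw [← Real.rpow_add hp]
    norm_num
  have hIJ : I ⊆ J := by
    refine hIp.subset_of_closure_inter_subset hJo ⟨x, hxI, hxJ⟩ ?_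
    rintro y ⟨hyc, hyI⟩
    have hca : ContinuousAt (fun t => |f t| * (m * t + q) ^ 2) y :=
      (hderiv y hyI).continuousAt.abs.mul (by fun_prop)
    have h1 := hca.continuousWithinAt.mem_closure_image hyc
    have h2 : |f y| * (m * y + q) ^ 2 = 1 := by
      have : (fun t => |f t| * (m * t + q) ^ 2) '' J ⊆ {1} := by
        rintro _ ⟨t, ht, rfl⟩
        exact key t ht
      simpa using closure_mono this h1
    have hy0 : f y ≠ 0 := fun h => by simp [h] at h2
    have hp : IsPreconnected (insert y J) :=
      hJp.subset_closure (Set.subset_insert _ _) (Set.insert_subset hyc subset_closure)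
    exact hp.subset_connectedComponentIn (Set.mem_insert_of_mem _ hxJ)
      (Set.insert_subset (show y ∈ S from ⟨hyI, hy0⟩) hJS) (Set.mem_insert _ _)
  have hne : ∀ t ∈ I, f t ≠ 0 := fun t ht => (hJS (hIJ ht)).2
  have hsgn : ∀ s ∈ I, ∀ t ∈ I, 0 < f s → 0 < f t := fun s hs t ht h => by
    by_contra h'
    obtain ⟨z, hz, hz0⟩ := hIp.intermediate_value ht hs hcont
      (show (0 : ℝ) ∈ Set.Icc (f t) (f s) from ⟨not_lt.mp h', h.le⟩)
    exact hne z hz hz0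
  have key2 : ∀ s ∈ I, ∀ t ∈ I, f s * (m * s + q) ^ 2 = f t * (m * t + q) ^ 2 := by
    intro s hs t ht
    have ks := key s (hIJ hs)
    have kt := key t (hIJ ht)
    by_cases h : 0 < f s
    · rw [abs_of_pos h] at ks
      rw [abs_of_pos (hsgn s hs t ht h)] at kt
      rw [ks, kt]
    · have h' : ¬ 0 < f t := fun h' => h (hsgn t ht s hs h')
      rw [abs_of_nonpos (not_lt.mp h)] at ks
      rw [abs_of_nonpos (not_lt.mp h')] at kt
      linarith
  have hm : m ≠ 0 := by
    rintro rfl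
    obtain ⟨s, hs, t, ht, hst⟩ := hnonconst
    have h1 := key2 s hs t ht
    have h2 := key s (hIJ hs)
    simp only [zero_mul, zero_add] at h1 h2
    exact hst (mul_right_cancel₀ (fun h => by simp [h] at h2) h1)
  have hlin : ∀ t, m * t + q = m * (t - -q / m) := fun t => by field_simp; ring
  have hb : -q / m ∉ I := fun hb => by
    have := key _ (hIJ hb)
    rw [hlin] at this
    simp at this
  have hsub : ∀ t ∈ I, t - -q / m ≠ 0 := fun t ht h => hb (by rwa [← sub_eq_zero.mp h])
  refine ⟨hne, f x * (x - -q / m) ^ 2, mul_ne_zero hx0 (pow_ne_zero 2 (hsub x hxI)), -q / m, hb,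
    fun t ht => ?_⟩
  have h := key2 t ht x hxI
  rw [hlin, hlin, mul_pow, mul_pow] at h
  rw [eq_mul_inv_iff_mul_eq₀ (pow_ne_zero 2 (hsub t ht))]
  apply mul_left_cancel₀ (pow_ne_zero 2 hm)
  linear_combination h
end

section
/- Let I ⊆ ℝ be a nonempty open interval, let m ≥ 1, and let S be a vector space of real-valued functions on I of finite dimension m that is closed under the pointwise absolute-value operation ψ ↦ |ψ| and under some m-argument operation Π sending any ψ₁, …, ψₘ ∈ S to a function Π(ψ₁,…,ψₘ) ∈ S that is nonnegative everywhere on I and vanishes at a point t ∈ I exactly when the product ψ₁(t)⋯ψₘ(t) vanishes. Let f : I → ℝ be continuously differentiable and nonconstant, and assume that the functions t ↦ |f(t)|^{1/2} and t ↦ |f′(t)|^{1/3} both belong to S. Then f(t) ≠ 0 for every t ∈ I, and there exist a real number ε ≠ 0 and a real number b ∉ I such that f(t) = ε·(t − b)^{−2} for all t ∈ I. -/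
open Set Filter Topology in
theorem aux_finite {X : Type*} (S : Submodule ℝ (X → ℝ)) (m : ℕ) (hm : 1 ≤ m)
    (hdim : Module.finrank ℝ S = m)
    (habs : ∀ ψ ∈ S, (fun t => |ψ t|) ∈ S) (u v : X → ℝ) (hu : u ∈ S) (hv : v ∈ S)
    (hu0 : ∀ t, 0 ≤ u t) :
    {r : ℝ | ∃ t, u t ≠ 0 ∧ r = v t / u t}.Finite := by
  by_contra hinf
  have hinf : {r : ℝ | ∃ t, u t ≠ 0 ∧ r = v t / u t}.Infinite := hinf
  obtain ⟨s, hs, hcard⟩ := hinf.exists_subset_card_eq (m + 2)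
  let r := s.orderEmbOfFin hcard
  have hr : ∀ i, ∃ t, u t ≠ 0 ∧ r i = v t / u t := fun i => hs (s.orderEmbOfFin_mem hcard i)
  choose p hp0 hp using hr
  have hpv : ∀ i, v (p i) = r i * u (p i) := fun i => by
    rw [hp i, div_mul_cancel₀ _ (hp0 i)]
  have hpos : ∀ i, 0 < u (p i) := fun i => lt_of_le_of_ne (hu0 _) (hp0 i).symm
  haveI : Module.Finite ℝ S := Module.finite_of_finrank_pos (by omega)
  let w : Fin (m + 1) → X → ℝ := fun k => v - r k.castSucc • u
  have hw : ∀ k, w k ∈ S := fun k => S.sub_mem hv (S.smul_mem _ hu)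
  let φ : Fin (m + 1) → S := fun k =>
    ⟨w k + (fun t => |w k t|), S.add_mem (hw k) (habs _ (hw k))⟩
  let L : S →ₗ[ℝ] (Fin (m + 1) → ℝ) :=
    (LinearMap.funLeft ℝ ℝ (fun j : Fin (m + 1) => p j.succ)).comp S.subtype
  let M : Matrix (Fin (m + 1)) (Fin (m + 1)) ℝ := Matrix.of fun k j => (φ k : X → ℝ) (p j.succ)
  have hval : ∀ k j, w k (p j) = (r j - r k.castSucc) * u (p j) := fun k j => by
    simp only [w, Pi.sub_apply, Pi.smul_apply, smul_eq_mul, hpv]; ring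
  have hM : ∀ k j, M k j = w k (p j.succ) + |w k (p j.succ)| := fun k j => rfl
  have htri : M.BlockTriangular id := by
    intro k j hjk
    have hjk : j < k := hjk
    have h1 : r j.succ ≤ r k.castSucc := r.monotone (by
      rw [Fin.le_def]; simp; omega)
    have h2 : w k (p j.succ) ≤ 0 := by
      rw [hval]; exact mul_nonpos_of_nonpos_of_nonneg (by linarith) (hu0 _)
    rw [hM, abs_of_nonpos h2]; ring
  have hdet : M.det ≠ 0 := by
    rw [Matrix.det_of_upperTriangular htri, Finset.prod_ne_zero_iff]
    intro k _
    have h1 : r k.castSucc < r k.succ := r.strictMono (by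
      rw [Fin.lt_def]; simp)
    have h2 : 0 < w k (p k.succ) := by
      rw [hval]; exact mul_pos (by linarith) (hpos _)
    rw [hM, abs_of_pos h2]; positivity
  have hli : LinearIndependent ℝ (L ∘ φ) := Matrix.linearIndependent_rows_of_det_ne_zero hdet
  have := (LinearIndependent.of_comp L hli).fintype_card_le_finrank
  rw [hdim] at this
  simp at this

open Set Filter Topology in
theorem aux_const {I : Set ℝ} (hI : IsPreconnected I) {h : ℝ → ℝ} (hc : ContinuousOn h I)
    (hfin : (h '' I).Finite) {x y : ℝ} (hx : x ∈ I) (hy : y ∈ I) : h x = h y := by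
  exact hfin.countable.isTotallyDisconnected _ subset_rfl (hI.image h hc)
    (mem_image_of_mem h hx) (mem_image_of_mem h hy)

open Set Filter Topology in
theorem aux_zero_right {f f' : ℝ → ℝ} {K a b : ℝ} (hK : 0 ≤ K)
    (hd : ∀ t ∈ Icc a b, HasDerivAt f (f' t) t)
    (hb : ∀ t ∈ Icc a b, |f' t| ≤ K * Real.sqrt |f t| ^ 3) (ha : f a = 0) :
    ∀ t ∈ Icc a b, f t = 0 := by
  have hcont : ContinuousOn f (Icc a b) := fun t ht => (hd t ht).continuousAt.continuousWithinAt
  obtain ⟨C, hC⟩ := isCompact_Icc.exists_bound_of_continuousOn hcont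
  refine eq_zero_of_abs_deriv_le_mul_abs_self_of_eq_zero_right (f' := f') (K := K * Real.sqrt C)
    hcont (fun x hx => (hd x (Ico_subset_Icc_self hx)).hasDerivWithinAt) ha ?_
  intro x hx
  have hx := Ico_subset_Icc_self hx
  have h1 : |f x| ≤ C := hC x hx
  have h2 := Real.sqrt_le_sqrt h1
  have h3 := Real.sq_sqrt (abs_nonneg (f x))
  calc ‖f' x‖ ≤ K * Real.sqrt |f x| ^ 3 := hb x hx
    _ = K * Real.sqrt |f x| * (Real.sqrt |f x| ^ 2) := by ring
    _ ≤ K * Real.sqrt C * ‖f x‖ := by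
      rw [h3, Real.norm_eq_abs]; gcongr

open Set Filter Topology in
theorem aux_zero {I : Set ℝ} (hIconn : I.OrdConnected) {f f' : ℝ → ℝ} {K : ℝ} (hK : 0 ≤ K)
    (hd : ∀ t ∈ I, HasDerivAt f (f' t) t)
    (hb : ∀ t ∈ I, |f' t| ≤ K * Real.sqrt |f t| ^ 3) {a : ℝ} (haI : a ∈ I) (ha : f a = 0) :
    ∀ t ∈ I, f t = 0 := by
  intro t ht
  rcases le_total a t with h | h
  · have hs : Icc a t ⊆ I := hIconn.out haI ht
    exact aux_zero_right hK (fun x hx => hd x (hs hx)) (fun x hx => hb x (hs hx)) ha t ⟨h, le_rfl⟩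
  · have hs : Icc t a ⊆ I := hIconn.out ht haI
    have key := aux_zero_right (f := fun x => f (-x)) (f' := fun x => -f' (-x)) (a := -a) (b := -t)
      hK (fun x hx => by
        have hx' : -x ∈ I := hs ⟨by linarith [hx.2], by linarith [hx.1]⟩
        have := (hd _ hx').comp x (hasDerivAt_neg x)
        simpa [Function.comp_def] using this)
      (fun x hx => by
        have hx' : -x ∈ I := hs ⟨by linarith [hx.2], by linarith [hx.1]⟩
        simpa using hb _ hx') (by simpa using ha) (-t) ⟨by linarith, le_rfl⟩
    simpa using key

open Set Filter Topology in
theorem aux_pos {I : Set ℝ} (hI : IsOpen I) (hIc : IsPreconnected I) (f f' : ℝ → ℝ)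
    (hderiv : ∀ t ∈ I, HasDerivAt f (f' t) t) (hC1 : ContinuousOn f' I)
    (hnonconst : ∃ s ∈ I, ∃ t ∈ I, f s ≠ f t)
    (hpos : ∀ t ∈ I, 0 < f t)
    (hfin : {q : ℝ | ∃ t ∈ I, f t ≠ 0 ∧ q = |f' t| / Real.sqrt |f t| ^ 3}.Finite) :
    ∃ ε : ℝ, ε ≠ 0 ∧ ∃ b : ℝ, b ∉ I ∧ ∀ t ∈ I, f t = ε * ((t - b) ^ 2)⁻¹ := by
  have hcf : ContinuousOn f I := fun t ht => (hderiv t ht).continuousAt.continuousWithinAt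
  have hs : ∀ t ∈ I, 0 < Real.sqrt (f t) := fun t ht => Real.sqrt_pos.2 (hpos t ht)
  set h : ℝ → ℝ := fun t => f' t / Real.sqrt (f t) ^ 3 with hh
  have hch : ContinuousOn h I :=
    hC1.div (hcf.sqrt.pow 3) (fun t ht => (pow_pos (hs t ht) 3).ne')
  have hfinh : (h '' I).Finite := by
    refine (hfin.union (hfin.image (fun x => -x))).subset ?_
    rintro _ ⟨t, ht, rfl⟩
    have hq : |f' t| / Real.sqrt |f t| ^ 3 ∈
      {q : ℝ | ∃ t ∈ I, f t ≠ 0 ∧ q = |f' t| / Real.sqrt |f t| ^ 3} :=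
      ⟨t, ht, (hpos t ht).ne', rfl⟩
    rcases le_total 0 (f' t) with h0 | h0
    · left
      rw [abs_of_nonneg h0, abs_of_pos (hpos t ht)] at hq
      exact hq
    · right
      refine ⟨_, hq, ?_⟩
      simp only [hh]
      rw [abs_of_nonpos h0, abs_of_pos (hpos t ht)]
      ring
  obtain ⟨s0, hs0, t0, ht0, hne⟩ := hnonconst
  set d : ℝ := -(h s0) / 2 with hd
  set G : ℝ → ℝ := fun t => (Real.sqrt (f t))⁻¹ - d * t with hG
  have hGd : ∀ t ∈ I, HasDerivAt G 0 t := by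
    intro t ht
    have h1 := ((hderiv t ht).sqrt (hpos t ht).ne').inv (hs t ht).ne'
    have h2 := h1.sub ((hasDerivAt_id t).const_mul d)
    refine h2.congr_deriv ?_
    have h3 : h s0 = h t := aux_const hIc hch hfinh hs0 ht
    rw [hd, h3]
    simp only [hh]
    have := (hs t ht).ne'
    field_simp
    ring
  have hGc : ∀ t ∈ I, G t = G s0 := fun t ht =>
    hI.is_const_of_deriv_eq_zero hIc
      (fun x hx => (hGd x hx).differentiableAt.differentiableWithinAt)
      (fun x hx => (hGd x hx).deriv) ht hs0
  set e := G s0 with he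
  have haff : ∀ t ∈ I, (Real.sqrt (f t))⁻¹ = d * t + e := fun t ht => by
    rw [← hGc t ht]; simp only [hG]; ring
  have hf : ∀ t ∈ I, f t = ((d * t + e) ^ 2)⁻¹ := fun t ht => by
    rw [← haff t ht, inv_pow, inv_inv, Real.sq_sqrt (hpos t ht).le]
  have hd0 : d ≠ 0 := by
    intro h0
    apply hne
    rw [hf _ hs0, hf _ ht0, h0]; simp
  refine ⟨(d ^ 2)⁻¹, by positivity, -e / d, ?_, ?_⟩
  · intro hb
    have h1 := haff _ hb
    have h2 := inv_pos.2 (hs _ hb)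
    rw [h1] at h2
    have : d * (-e / d) + e = 0 := by field_simp; ring
    linarith
  · intro t ht
    rw [hf t ht, ← mul_inv, ← mul_pow]
    congr 2
    field_simp
    ring

/-- Let `I ⊆ ℝ` be a nonempty open interval and let `S` be a vector space of
real-valued functions on `I` of finite dimension `m ≥ 1`, closed under the pointwise
absolute value and under some `m`-argument operation `Π` producing nonnegative
functions in `S` having exactly the same zeros as the corresponding pointwise
products.  If `f` is a nonconstant `C¹` function on `I` such that `|f|^{1/2}` and
`|f'|^{1/3}` both belong to `S`, then `f` is nowhere zero on `I` and
`f(t) = ε (t - b)⁻²` for some `ε ≠ 0` and some `b ∉ I`. -/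
theorem stmt_3 (I : Set ℝ) (hI : IsOpen I) (hIconn : I.OrdConnected)
    (hIne : I.Nonempty)
    (S : Submodule ℝ (I → ℝ)) (m : ℕ) (hm : 1 ≤ m)
    (hdim : Module.finrank ℝ S = m)
    (habs : ∀ ψ ∈ S, (fun t => |ψ t|) ∈ S)
    (Pi : (Fin m → (I → ℝ)) → (I → ℝ))
    (hPiMem : ∀ ψ : Fin m → (I → ℝ), (∀ i, ψ i ∈ S) → Pi ψ ∈ S)
    (hPiNonneg : ∀ ψ : Fin m → (I → ℝ), (∀ i, ψ i ∈ S) → ∀ t, 0 ≤ Pi ψ t)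
    (hPiZeros : ∀ ψ : Fin m → (I → ℝ), (∀ i, ψ i ∈ S) →
      ∀ t, Pi ψ t = 0 ↔ (∏ i, ψ i t) = 0)
    (f f' : ℝ → ℝ) (hderiv : ∀ t ∈ I, HasDerivAt f (f' t) t)
    (hC1 : ContinuousOn f' I)
    (hnonconst : ∃ s ∈ I, ∃ t ∈ I, f s ≠ f t)
    (hfS : (fun t : I => |f t| ^ ((1 : ℝ) / 2)) ∈ S)
    (hf'S : (fun t : I => |f' t| ^ ((1 : ℝ) / 3)) ∈ S) :
    (∀ t ∈ I, f t ≠ 0) ∧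
      ∃ ε : ℝ, ε ≠ 0 ∧ ∃ b : ℝ, b ∉ I ∧ ∀ t ∈ I, f t = ε * ((t - b) ^ 2)⁻¹ := by
  classical
  have hIc : IsPreconnected I := hIconn.isPreconnected
  have hcf : ContinuousOn f I := fun t ht => (hderiv t ht).continuousAt.continuousWithinAt
  have hfin0 := aux_finite S m hm hdim habs _ _ hfS hf'S
    (fun t => Real.rpow_nonneg (abs_nonneg _) _)
  have hfin : {q : ℝ | ∃ t ∈ I, f t ≠ 0 ∧ q = |f' t| / Real.sqrt |f t| ^ 3}.Finite := by
    refine (hfin0.image (fun x => x ^ 3)).subset ?_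
    rintro _ ⟨t, ht, h0, rfl⟩
    refine ⟨_, ⟨⟨t, ht⟩, ?_, rfl⟩, ?_⟩
    · exact (Real.rpow_pos_of_pos (abs_pos.2 h0) _).ne'
    · simp only [div_pow]
      rw [Real.sqrt_eq_rpow, ← Real.rpow_natCast (|f' t| ^ ((1 : ℝ) / 3)) 3,
        ← Real.rpow_mul (abs_nonneg _)]
      norm_num
  obtain ⟨K0, hK0⟩ := hfin.bddAbove
  set K := max K0 0 with hK
  have hKn : 0 ≤ K := le_max_right _ _
  have hb1 : ∀ t ∈ I, f t ≠ 0 → |f' t| ≤ K * Real.sqrt |f t| ^ 3 := by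
    intro t ht h0
    have h1 : |f' t| / Real.sqrt |f t| ^ 3 ≤ K :=
      (hK0 ⟨t, ht, h0, rfl⟩).trans (le_max_left _ _)
    have h2 : 0 < Real.sqrt |f t| ^ 3 := pow_pos (Real.sqrt_pos.2 (abs_pos.2 h0)) 3
    rwa [div_le_iff₀ h2] at h1
  have hb : ∀ t ∈ I, |f' t| ≤ K * Real.sqrt |f t| ^ 3 := by
    intro t ht
    by_cases hd0 : f' t = 0
    · rw [hd0, abs_zero]; positivity
    have hev : ∀ᶠ z in nhdsWithin t {t}ᶜ, |f' z| ≤ K * Real.sqrt |f z| ^ 3 := by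
      have h1 : ∀ᶠ z in nhdsWithin t {t}ᶜ, f z ≠ 0 := (hderiv t ht).eventually_ne hd0
      have h2 : ∀ᶠ z in nhdsWithin t {t}ᶜ, z ∈ I := nhdsWithin_le_nhds (hI.mem_nhds ht)
      filter_upwards [h1, h2] with z hz1 hz2 using hb1 z hz2 hz1
    have hc' : ContinuousAt f' t := hC1.continuousAt (hI.mem_nhds ht)
    have hc : ContinuousAt f t := (hderiv t ht).continuousAt
    have hl : ContinuousAt (fun z => |f' z|) t := hc'.abs
    have hr : ContinuousAt (fun z => K * Real.sqrt |f z| ^ 3) t :=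
      continuousAt_const.mul ((Real.continuous_sqrt.continuousAt.comp hc.abs).pow 3)
    exact le_of_tendsto_of_tendsto (hl.tendsto.mono_left nhdsWithin_le_nhds)
      (hr.tendsto.mono_left nhdsWithin_le_nhds) hev
  have hne : ∀ t ∈ I, f t ≠ 0 := by
    intro a ha h0
    have hz := aux_zero hIconn hKn hderiv hb ha h0
    obtain ⟨s, hs, t, ht, hst⟩ := hnonconst
    exact hst (by rw [hz s hs, hz t ht])
  refine ⟨hne, ?_⟩
  obtain ⟨x0, hx0⟩ := hIne
  have hsign : (∀ t ∈ I, 0 < f t) ∨ (∀ t ∈ I, f t < 0) := by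
    by_contra hcon
    push Not at hcon
    obtain ⟨⟨x, hx, hx1⟩, ⟨y, hy, hy1⟩⟩ := hcon
    obtain ⟨z, hz, hz0⟩ := hIc.intermediate_value hx hy hcf ⟨hx1, hy1⟩
    exact hne z hz hz0
  rcases hsign with hp | hn
  · exact aux_pos hI hIc f f' hderiv hC1 hnonconst hp hfin
  · obtain ⟨ε, hε, b, hbI, hfb⟩ := aux_pos hI hIc (fun t => -f t) (fun t => -f' t)
      (fun t ht => (hderiv t ht).neg) hC1.neg
      (by
        obtain ⟨s, hs, t, ht, hst⟩ := hnonconst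
        exact ⟨s, hs, t, ht, fun h => hst (neg_injective h)⟩)
      (fun t ht => neg_pos.2 (hn t ht)) (by simpa using hfin)
    refine ⟨-ε, neg_ne_zero.2 hε, b, hbI, fun t ht => ?_⟩
    have := hfb t ht
    linarith
end

section
/- Let g : ℝ → ℝ be continuously differentiable. Then the image under g of its critical set, that is, the set g({x ∈ ℝ : g′(x) = 0}), has Lebesgue measure zero. -/
/-- Sard's theorem for `C¹` functions `ℝ → ℝ`: the set of critical values of a
continuously differentiable function `g : ℝ → ℝ` has Lebesgue measure zero. -/
theorem stmt_7 (g : ℝ → ℝ) (hg : ContDiff ℝ 1 g) :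
    MeasureTheory.volume (g '' {x : ℝ | deriv g x = 0}) = 0 := by
  refine MeasureTheory.addHaar_image_eq_zero_of_det_fderivWithin_eq_zero MeasureTheory.volume
    (f' := fun _ => (0 : ℝ →L[ℝ] ℝ)) ?_ ?_
  · intro x hx
    have hd : HasDerivAt g (deriv g x) x := (hg.differentiable one_ne_zero x).hasDerivAt
    have h0 : deriv g x = 0 := hx
    rw [h0] at hd
    have h1 : HasFDerivAt g (0 : ℝ →L[ℝ] ℝ) x := by
      have h2 := hd.hasFDerivAt
      have h3 : ContinuousLinearMap.toSpanSingleton ℝ (0 : ℝ) = 0 := by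
        ext
        simp
      exact h3 ▸ h2
    exact h1.hasFDerivWithinAt
  · intro x _
    simp [ContinuousLinearMap.det]
end
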